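/- arXiv:2305.00349 — 3 statements merged into one kernel-verified Lean document; each statement's English description precedes it below -/
import Mathlib

section
/- Robustness of the generalized frontdoor estimating function, scenario 3 (outcome regression b₀ and treatment-given-covariates model correct, mediator ratio and h arbitrary): define b₀(m,l) = E(Y | A=a°, M=m, L=l), h†(l) = ∑_m b₀(m,l)·P(M=m | A=a†, L=l), ψ₃ = E(h†(L) | A=a°), and Ψ = P(A=a†)·E(Y | A=a†) + P(A=a°)·ψ₃. Then for ANY functions w : ℳ×ℒ → ℝ, h* : ℒ → ℝ and ANY real number ψ₃*, E[ 1{A=a†}·Y + 1{A=a°}·ψ₃* + 1{A=a°}·w(M,L)·(Y − b₀(M,L)) + 1{A=a†}·(P(A=a° | L)/P(A=a† | L))·(b₀(M,L) − h*(L)) + 1{A=a°}·(h*(L) − ψ₃*) ] = Ψ, where P(A=a | L) denotes the random variable ω ↦ P(A=a | L=L(ω)). -/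
open scoped Classical
open Finset

/-- Probability of an event `S` under pmf `p` on a finite sample space. -/
noncomputable def Pr {Ω : Type*} [Fintype Ω] (p : Ω → ℝ) (S : Ω → Prop) : ℝ :=
  ∑ ω, if S ω then p ω else 0

/-- Expectation of `X` under pmf `p`. -/
noncomputable def Ex {Ω : Type*} [Fintype Ω] (p : Ω → ℝ) (X : Ω → ℝ) : ℝ :=
  ∑ ω, p ω * X ω

/-- Conditional probability `P(E | S)`. -/
noncomputable def CPr {Ω : Type*} [Fintype Ω] (p : Ω → ℝ) (E S : Ω → Prop) : ℝ :=
  Pr p (fun ω => E ω ∧ S ω) / Pr p S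

/-- Conditional expectation `E(X | S) = E(X · 1_S) / P(S)`. -/
noncomputable def CEx {Ω : Type*} [Fintype Ω] (p : Ω → ℝ) (X : Ω → ℝ) (S : Ω → Prop) : ℝ :=
  Ex p (fun ω => X ω * (if S ω then 1 else 0)) / Pr p S

/-- Indicator of a proposition, as a real number. -/
noncomputable def ind (P : Prop) : ℝ := if P then 1 else 0

theorem aux_fiber {Ω κ : Type*} [Fintype Ω] [Fintype κ] (K : Ω → κ) (f : Ω → ℝ)
    (h : ∀ x, ∑ ω, (if K ω = x then f ω else 0) = 0) : ∑ ω, f ω = 0 := by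
  have h1 : ∑ ω, f ω = ∑ x, ∑ ω, (if K ω = x then f ω else 0) := by
    rw [Finset.sum_comm]
    refine Finset.sum_congr rfl fun ω _ => ?_
    simp
  rw [h1]
  exact Finset.sum_eq_zero fun x _ => h x

theorem aux_center {Ω : Type*} [Fintype Ω] (p : Ω → ℝ) (Y : Ω → ℝ) (S : Ω → Prop)
    (hS : Pr p S ≠ 0) : ∑ ω, (if S ω then p ω * (Y ω - CEx p Y S) else 0) = 0 := by
  have h1 : CEx p Y S * Pr p S = ∑ ω, p ω * (Y ω * (if S ω then 1 else 0)) := by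
    unfold CEx
    rw [div_mul_cancel₀ _ hS]
    rfl
  have h2 : ∑ ω, (if S ω then p ω * (Y ω - CEx p Y S) else 0)
      = ∑ ω, p ω * (Y ω * (if S ω then 1 else 0)) - CEx p Y S * Pr p S := by
    unfold Pr
    rw [Finset.mul_sum, ← Finset.sum_sub_distrib]
    refine Finset.sum_congr rfl fun ω _ => ?_
    split_ifs <;> ring
  rw [h2, h1, sub_self]

theorem aux_le {Ω : Type*} [Fintype Ω] (p : Ω → ℝ) (hp : ∀ ω, 0 ≤ p ω) (S T : Ω → Prop)
    (h : ∀ ω, S ω → T ω) : Pr p S ≤ Pr p T := by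
  unfold Pr
  refine Finset.sum_le_sum fun ω _ => ?_
  have := h ω
  have := hp ω
  split_ifs <;> first | linarith | tauto

theorem aux_ex {Ω : Type*} [Fintype Ω] (p : Ω → ℝ) (Y : Ω → ℝ) (S : Ω → Prop)
    (hS : Pr p S ≠ 0) : Pr p S * CEx p Y S = ∑ ω, p ω * (ind (S ω) * Y ω) := by
  unfold CEx
  rw [mul_div_cancel₀ _ hS]
  unfold Ex ind
  refine Finset.sum_congr rfl fun ω _ => ?_
  ring

/-- Robustness of the generalized frontdoor estimating function,
scenario 3 (outcome regression `b0` and treatment-given-covariates model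
correct, mediator ratio and `h` arbitrary). -/
theorem generalized_frontdoor_robust_scenario3
    {Ω 𝓜 𝓛 α : Type*} [Fintype Ω] [Fintype 𝓜] [Fintype 𝓛]
    (p : Ω → ℝ) (hp : ∀ ω, 0 ≤ p ω) (hsum : ∑ ω, p ω = 1)
    (A : Ω → α) (adag acirc : α) (hne : adag ≠ acirc)
    (hA : ∀ ω, A ω = adag ∨ A ω = acirc)
    (M : Ω → 𝓜) (L : Ω → 𝓛) (Y : Ω → ℝ)
    (hpos : ∀ a, (a = adag ∨ a = acirc) → ∀ m : 𝓜, ∀ l : 𝓛,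
      0 < Pr p (fun ω => A ω = a ∧ M ω = m ∧ L ω = l))
    (b0 : 𝓜 → 𝓛 → ℝ)
    (hb0 : ∀ m l, b0 m l = CEx p Y (fun ω => A ω = acirc ∧ M ω = m ∧ L ω = l))
    (hdag : 𝓛 → ℝ)
    (hhdag : ∀ l, hdag l = ∑ m : 𝓜,
      b0 m l * CPr p (fun ω => M ω = m) (fun ω => A ω = adag ∧ L ω = l))
    (ψ3 : ℝ)
    (hψ3 : ψ3 = CEx p (fun ω => hdag (L ω)) (fun ω => A ω = acirc))
    (Ψ : ℝ)
    (hΨ : Ψ = Pr p (fun ω => A ω = adag) * CEx p Y (fun ω => A ω = adag) +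
              Pr p (fun ω => A ω = acirc) * ψ3)
    (w : 𝓜 → 𝓛 → ℝ) (hstar : 𝓛 → ℝ) (ψ3star : ℝ) :
    Ex p (fun ω =>
      ind (A ω = adag) * Y ω + ind (A ω = acirc) * ψ3star +
      ind (A ω = acirc) * w (M ω) (L ω) * (Y ω - b0 (M ω) (L ω)) +
      ind (A ω = adag) *
        (CPr p (fun ω' => A ω' = acirc) (fun ω' => L ω' = L ω) /
         CPr p (fun ω' => A ω' = adag) (fun ω' => L ω' = L ω)) *
        (b0 (M ω) (L ω) - hstar (L ω)) +
      ind (A ω = acirc) * (hstar (L ω) - ψ3star)) = Ψ := by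
  obtain ⟨ω0⟩ : Nonempty Ω := by
    by_contra hh
    rw [not_nonempty_iff] at hh
    simp at hsum
  have hpAL : ∀ a, (a = adag ∨ a = acirc) → ∀ l, 0 < Pr p (fun ω => A ω = a ∧ L ω = l) :=
    fun a ha l => lt_of_lt_of_le (hpos a ha (M ω0) l) (aux_le p hp _ _ fun ω h => ⟨h.1, h.2.2⟩)
  have hpA : ∀ a, (a = adag ∨ a = acirc) → 0 < Pr p (fun ω => A ω = a) :=
    fun a ha => lt_of_lt_of_le (hpAL a ha (L ω0)) (aux_le p hp _ _ fun ω h => h.1)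
  have hpL : ∀ l, 0 < Pr p (fun ω => L ω = l) :=
    fun l => lt_of_lt_of_le (hpAL adag (Or.inl rfl) l) (aux_le p hp _ _ fun ω h => h.2)
  -- term 1
  have T1 : ∑ ω, p ω * (ind (A ω = acirc) * w (M ω) (L ω) * (Y ω - b0 (M ω) (L ω))) = 0 := by
    refine aux_fiber (fun ω => (M ω, L ω)) _ ?_
    rintro ⟨m, l⟩
    have h := aux_center p Y _ (hpos acirc (Or.inr rfl) m l).ne'
    rw [← hb0] at h
    have h' := congrArg (fun t => w m l * t) h
    simp only [mul_zero, Finset.mul_sum] at h'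
    refine Eq.trans ?_ h'
    refine Finset.sum_congr rfl fun ω _ => ?_
    by_cases h1 : M ω = m <;> by_cases h2 : L ω = l <;> by_cases h3 : A ω = acirc <;>
      simp [h1, h2, h3, ind]
    ring
  -- term 2
  have T2 : ∀ r : 𝓛 → ℝ,
      ∑ ω, p ω * (ind (A ω = adag) * r (L ω) * (b0 (M ω) (L ω) - hdag (L ω))) = 0 := by
    intro r
    refine aux_fiber L _ fun l => ?_
    have hq := (hpAL adag (Or.inl rfl) l).ne'
    have h1 : hdag l * Pr p (fun ω => A ω = adag ∧ L ω = l)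
        = ∑ ω, (if A ω = adag ∧ L ω = l then p ω * b0 (M ω) l else 0) := by
      rw [hhdag, Finset.sum_mul]
      have : ∀ m, b0 m l * CPr p (fun ω => M ω = m) (fun ω => A ω = adag ∧ L ω = l) *
          Pr p (fun ω => A ω = adag ∧ L ω = l)
          = ∑ ω, (if M ω = m then (if A ω = adag ∧ L ω = l then p ω * b0 m l else 0) else 0) := by
        intro m
        unfold CPr
        rw [mul_assoc, div_mul_cancel₀ _ hq]
        unfold Pr
        rw [Finset.mul_sum]
        refine Finset.sum_congr rfl fun ω _ => ?_
        by_cases h1 : M ω = m <;> by_cases h2 : A ω = adag ∧ L ω = l <;> simp [h1, h2]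
        ring
      rw [Finset.sum_congr rfl fun m _ => this m, Finset.sum_comm]
      refine Finset.sum_congr rfl fun ω _ => ?_
      simp
    have h2 : ∑ ω, (if L ω = l then
          p ω * (ind (A ω = adag) * r (L ω) * (b0 (M ω) (L ω) - hdag (L ω))) else 0)
        = r l * (∑ ω, (if A ω = adag ∧ L ω = l then p ω * b0 (M ω) l else 0)
          - hdag l * Pr p (fun ω => A ω = adag ∧ L ω = l)) := by
      unfold Pr
      rw [Finset.mul_sum, ← Finset.sum_sub_distrib, Finset.mul_sum]
      refine Finset.sum_congr rfl fun ω _ => ?_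
      by_cases h1 : L ω = l <;> by_cases h2 : A ω = adag <;> simp [h1, h2, ind]
      ring
    rw [h2, h1, sub_self, mul_zero]
  -- term 3
  have T3 : ∀ k : 𝓛 → ℝ,
      ∑ ω, p ω * (ind (A ω = adag) *
        (CPr p (fun ω' => A ω' = acirc) (fun ω' => L ω' = L ω) /
         CPr p (fun ω' => A ω' = adag) (fun ω' => L ω' = L ω)) * k (L ω)
        - ind (A ω = acirc) * k (L ω)) = 0 := by
    intro k
    refine aux_fiber L _ fun l => ?_
    have hd := (hpAL adag (Or.inl rfl) l).ne'
    have hl := (hpL l).ne'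
    have h2 : ∑ ω, (if L ω = l then p ω * (ind (A ω = adag) *
        (CPr p (fun ω' => A ω' = acirc) (fun ω' => L ω' = L ω) /
         CPr p (fun ω' => A ω' = adag) (fun ω' => L ω' = L ω)) * k (L ω)
        - ind (A ω = acirc) * k (L ω)) else 0)
        = k l * ((CPr p (fun ω' => A ω' = acirc) (fun ω' => L ω' = l) /
         CPr p (fun ω' => A ω' = adag) (fun ω' => L ω' = l)) *
          Pr p (fun ω => A ω = adag ∧ L ω = l) - Pr p (fun ω => A ω = acirc ∧ L ω = l)) := by
      generalize hR : (fun l => CPr p (fun ω' => A ω' = acirc) (fun ω' => L ω' = l) /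
         CPr p (fun ω' => A ω' = adag) (fun ω' => L ω' = l)) = R
      have hR' : ∀ l, CPr p (fun ω' => A ω' = acirc) (fun ω' => L ω' = l) /
         CPr p (fun ω' => A ω' = adag) (fun ω' => L ω' = l) = R l := fun l => congrFun hR l
      simp only [hR']
      unfold Pr
      rw [Finset.mul_sum, ← Finset.sum_sub_distrib, Finset.mul_sum]
      refine Finset.sum_congr rfl fun ω _ => ?_
      by_cases h1 : L ω = l
      · simp only [h1, and_true, if_true, ind]
        split_ifs <;> ring
      · simp [h1]
    rw [h2]
    unfold CPr
    field_simp
    ring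
  rw [hΨ, hψ3, aux_ex p _ _ (hpA adag (Or.inl rfl)).ne', aux_ex p _ _ (hpA acirc (Or.inr rfl)).ne']
  have t2 := T2 (fun l => CPr p (fun ω' => A ω' = acirc) (fun ω' => L ω' = l) /
         CPr p (fun ω' => A ω' = adag) (fun ω' => L ω' = l))
  have t3 := T3 (fun l => hdag l - hstar l)
  have key := congrArg₂ (· + ·) (congrArg₂ (· + ·) T1 t2) t3
  simp only [add_zero, ← Finset.sum_add_distrib] at key
  rw [← Finset.sum_add_distrib, ← sub_eq_zero, ← key]
  unfold Ex
  rw [← Finset.sum_sub_distrib]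
  refine Finset.sum_congr rfl fun ω _ => ?_
  ring
end

section
/- The efficient influence function of the generalized frontdoor formula has mean zero: define b₀(m,l) = E(Y | A=a°, M=m, L=l), h†(l) = ∑_m b₀(m,l)·P(M=m | A=a†, L=l), ψ₃ = E(h†(L) | A=a°), and Ψ = P(A=a†)·E(Y | A=a†) + P(A=a°)·ψ₃. Then E[ 1{A=a†}·Y + 1{A=a°}·ψ₃ + 1{A=a°}·(P(M | A=a†, L)/P(M | A=a°, L))·(Y − b₀(M,L)) + 1{A=a†}·(P(A=a° | L)/P(A=a† | L))·(b₀(M,L) − h†(L)) + 1{A=a°}·(h†(L) − ψ₃) − Ψ ] = 0, where P(M | A=a, L) denotes the random variable ω ↦ P(M=M(ω) | A=a, L=L(ω)) and P(A=a | L) denotes ω ↦ P(A=a | L=L(ω)). -/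
open scoped Classical
open Finset

lemma Pr_mul_CEx {Ω : Type*} [Fintype Ω] (p : Ω → ℝ) (hp : ∀ ω, 0 ≤ p ω)
    (X : Ω → ℝ) (S : Ω → Prop) :
    Pr p S * CEx p X S = ∑ ω, if S ω then p ω * X ω else 0 := by
  have e : Ex p (fun ω => X ω * (if S ω then 1 else 0)) = ∑ ω, if S ω then p ω * X ω else 0 := by
    unfold Ex
    refine Finset.sum_congr rfl fun ω _ => ?_
    by_cases hS : S ω <;> simp [hS]
  unfold CEx
  rw [e]
  by_cases h : Pr p S = 0
  · rw [h, zero_mul]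
    unfold Pr at h
    rw [Finset.sum_eq_zero_iff_of_nonneg
      (fun ω _ => by split_ifs <;> simp [hp])] at h
    symm
    refine Finset.sum_eq_zero fun ω hω => ?_
    have := h ω hω
    split_ifs at this ⊢ <;> simp_all
  · field_simp

lemma Pr_mul_CPr {Ω : Type*} [Fintype Ω] (p : Ω → ℝ) (hp : ∀ ω, 0 ≤ p ω)
    (E S : Ω → Prop) :
    Pr p S * CPr p E S = ∑ ω, if E ω ∧ S ω then p ω else 0 := by
  have h := Pr_mul_CEx p hp (fun ω => if E ω then 1 else 0) S
  have e : CPr p E S = CEx p (fun ω => if E ω then 1 else 0) S := by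
    unfold CPr CEx Pr Ex
    congr 1
    refine Finset.sum_congr rfl fun ω _ => ?_
    by_cases h1 : E ω <;> by_cases h2 : S ω <;> simp [h1, h2]
  rw [e, h]
  refine Finset.sum_congr rfl fun ω _ => ?_
  by_cases h1 : E ω <;> by_cases h2 : S ω <;> simp [h1, h2]

lemma sum_fiber {Ω β : Type*} [Fintype Ω] [Fintype β] (f : Ω → β) (F : Ω → ℝ) :
    ∑ ω, F ω = ∑ b, ∑ ω, if f ω = b then F ω else 0 := by
  rw [Finset.sum_comm]
  simp

lemma T3_zero {Ω 𝓜 𝓛 α : Type*} [Fintype Ω] [Fintype 𝓜] [Fintype 𝓛]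
    (p : Ω → ℝ) (hp : ∀ ω, 0 ≤ p ω) (A : Ω → α) (c : α)
    (M : Ω → 𝓜) (L : Ω → 𝓛) (Y : Ω → ℝ) (b0 : 𝓜 → 𝓛 → ℝ)
    (hb0 : ∀ m l, b0 m l = CEx p Y (fun ω => A ω = c ∧ M ω = m ∧ L ω = l))
    (g : 𝓜 → 𝓛 → ℝ) :
    ∑ ω, p ω * (ind (A ω = c) * g (M ω) (L ω) * (Y ω - b0 (M ω) (L ω))) = 0 := by
  rw [sum_fiber M]
  refine Finset.sum_eq_zero fun m _ => ?_
  rw [sum_fiber L]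
  refine Finset.sum_eq_zero fun l _ => ?_
  have h := Pr_mul_CEx p hp Y (fun ω => A ω = c ∧ M ω = m ∧ L ω = l)
  rw [← hb0] at h
  have : g m l * ((∑ ω, if A ω = c ∧ M ω = m ∧ L ω = l then p ω * Y ω else 0)
      - Pr p (fun ω => A ω = c ∧ M ω = m ∧ L ω = l) * b0 m l) = 0 := by
    rw [h, mul_eq_zero, sub_eq_zero]
    right
    congr!
  refine Eq.trans ?_ this
  unfold Pr
  rw [Finset.sum_mul, ← Finset.sum_sub_distrib, Finset.mul_sum]
  refine Finset.sum_congr rfl fun ω _ => ?_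
  unfold ind
  by_cases h1 : A ω = c <;> by_cases h2 : M ω = m <;> by_cases h3 : L ω = l <;>
    simp [h1, h2, h3]
  ring

lemma T4_zero {Ω 𝓜 𝓛 α : Type*} [Fintype Ω] [Fintype 𝓜] [Fintype 𝓛]
    (p : Ω → ℝ) (hp : ∀ ω, 0 ≤ p ω) (A : Ω → α) (d : α)
    (M : Ω → 𝓜) (L : Ω → 𝓛) (b0 : 𝓜 → 𝓛 → ℝ) (hdag : 𝓛 → ℝ)
    (hhdag : ∀ l, hdag l = ∑ m : 𝓜,
      b0 m l * CPr p (fun ω => M ω = m) (fun ω => A ω = d ∧ L ω = l))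
    (r : 𝓛 → ℝ) :
    ∑ ω, p ω * (ind (A ω = d) * r (L ω) * (b0 (M ω) (L ω) - hdag (L ω))) = 0 := by
  rw [sum_fiber L]
  refine Finset.sum_eq_zero fun l _ => ?_
  have h : Pr p (fun ω => A ω = d ∧ L ω = l) * hdag l =
      ∑ ω, if A ω = d ∧ L ω = l then p ω * b0 (M ω) l else 0 := by
    rw [hhdag, Finset.mul_sum, sum_fiber M]
    refine Finset.sum_congr rfl fun m _ => ?_
    rw [mul_left_comm, Pr_mul_CPr p hp, Finset.mul_sum]
    refine Finset.sum_congr rfl fun ω _ => ?_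
    by_cases h1 : A ω = d <;> by_cases h2 : M ω = m <;> by_cases h3 : L ω = l <;>
      simp [h1, h2, h3, mul_comm]
  have : r l * ((∑ ω, if A ω = d ∧ L ω = l then p ω * b0 (M ω) l else 0)
      - Pr p (fun ω => A ω = d ∧ L ω = l) * hdag l) = 0 := by
    rw [h]; simp
  refine Eq.trans ?_ this
  unfold Pr
  rw [Finset.sum_mul, ← Finset.sum_sub_distrib, Finset.mul_sum]
  refine Finset.sum_congr rfl fun ω _ => ?_
  unfold ind
  by_cases h1 : A ω = d <;> by_cases h3 : L ω = l <;>
    simp [h1, h3]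
  ring

/-- The efficient influence function of the generalized frontdoor
formula has mean zero. -/
theorem generalized_frontdoor_eif_mean_zero
    {Ω 𝓜 𝓛 α : Type*} [Fintype Ω] [Fintype 𝓜] [Fintype 𝓛]
    (p : Ω → ℝ) (hp : ∀ ω, 0 ≤ p ω) (hsum : ∑ ω, p ω = 1)
    (A : Ω → α) (adag acirc : α) (hne : adag ≠ acirc)
    (hA : ∀ ω, A ω = adag ∨ A ω = acirc)
    (M : Ω → 𝓜) (L : Ω → 𝓛) (Y : Ω → ℝ)
    (hpos : ∀ a, (a = adag ∨ a = acirc) → ∀ m : 𝓜, ∀ l : 𝓛,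
      0 < Pr p (fun ω => A ω = a ∧ M ω = m ∧ L ω = l))
    (b0 : 𝓜 → 𝓛 → ℝ)
    (hb0 : ∀ m l, b0 m l = CEx p Y (fun ω => A ω = acirc ∧ M ω = m ∧ L ω = l))
    (hdag : 𝓛 → ℝ)
    (hhdag : ∀ l, hdag l = ∑ m : 𝓜,
      b0 m l * CPr p (fun ω => M ω = m) (fun ω => A ω = adag ∧ L ω = l))
    (ψ3 : ℝ)
    (hψ3 : ψ3 = CEx p (fun ω => hdag (L ω)) (fun ω => A ω = acirc))
    (Ψ : ℝ)
    (hΨ : Ψ = Pr p (fun ω => A ω = adag) * CEx p Y (fun ω => A ω = adag) +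
              Pr p (fun ω => A ω = acirc) * ψ3) :
    Ex p (fun ω =>
      ind (A ω = adag) * Y ω + ind (A ω = acirc) * ψ3 +
      ind (A ω = acirc) *
        (CPr p (fun ω' => M ω' = M ω) (fun ω' => A ω' = adag ∧ L ω' = L ω) /
         CPr p (fun ω' => M ω' = M ω) (fun ω' => A ω' = acirc ∧ L ω' = L ω)) *
        (Y ω - b0 (M ω) (L ω)) +
      ind (A ω = adag) *
        (CPr p (fun ω' => A ω' = acirc) (fun ω' => L ω' = L ω) /
         CPr p (fun ω' => A ω' = adag) (fun ω' => L ω' = L ω)) *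
        (b0 (M ω) (L ω) - hdag (L ω)) +
      ind (A ω = acirc) * (hdag (L ω) - ψ3) - Ψ) = 0 := by
  have t3 := T3_zero p hp A acirc M L Y b0 hb0 (fun m l =>
    CPr p (fun ω' => M ω' = m) (fun ω' => A ω' = adag ∧ L ω' = l) /
         CPr p (fun ω' => M ω' = m) (fun ω' => A ω' = acirc ∧ L ω' = l))
  have t4 := T4_zero p hp A adag M L b0 hdag hhdag (fun l =>
    CPr p (fun ω' => A ω' = acirc) (fun ω' => L ω' = l) /
         CPr p (fun ω' => A ω' = adag) (fun ω' => L ω' = l))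
  have h1 := Pr_mul_CEx p hp Y (fun ω => A ω = adag)
  have h2 := Pr_mul_CEx p hp (fun ω => hdag (L ω)) (fun ω => A ω = acirc)
  rw [← hψ3] at h2
  rw [h1, h2] at hΨ
  have h5 : ∑ ω, p ω * Ψ = Ψ := by rw [← Finset.sum_mul, hsum, one_mul]
  have key : (∑ ω, if A ω = adag then p ω * Y ω else 0) +
      (∑ ω, if A ω = acirc then p ω * hdag (L ω) else 0) - ∑ ω, p ω * Ψ = 0 := by
    rw [h5, hΨ]; ring
  have key2 := congrArg₂ (· + ·) (congrArg₂ (· + ·) key t3) t4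
  simp only [add_zero] at key2
  rw [← Finset.sum_add_distrib, ← Finset.sum_sub_distrib, ← Finset.sum_add_distrib,
    ← Finset.sum_add_distrib] at key2
  refine Eq.trans ?_ key2
  unfold Ex
  refine Finset.sum_congr rfl fun ω _ => ?_
  have i1 : (if A ω = adag then p ω * Y ω else 0) = ind (A ω = adag) * (p ω * Y ω) := by
    unfold ind; split_ifs <;> simp
  have i2 : (if A ω = acirc then p ω * hdag (L ω) else 0)
      = ind (A ω = acirc) * (p ω * hdag (L ω)) := by
    unfold ind; split_ifs <;> simp
  rw [i1, i2]
  ring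
end

section
/- Second-order remainder decomposition for the generalized frontdoor estimating function: let f(m|a,l) = P(M=m | A=a, L=l), f(a|l) = P(A=a | L=l), b₀(m,l) = E(Y | A=a°, M=m, L=l), h†(l) = ∑_m b₀(m,l)·f(m|a†,l), ψ₃ = E(h†(L) | A=a°). Let f̂ₘ : ℳ×{a†,a°}×ℒ → ℝ be any strictly positive function with ∑-free role of an estimated mediator density, f̂ₐ : {a†,a°}×ℒ → ℝ any strictly positive function with f̂ₐ(a†,l) + f̂ₐ(a°,l) = 1 for all l, and b̂₀ : ℳ×ℒ → ℝ, ĥ : ℒ → ℝ arbitrary functions. Then E[ 1{A=a°}·(f̂ₘ(M,a†,L)/f̂ₘ(M,a°,L))·(Y − b̂₀(M,L)) + 1{A=a†}·(f̂ₐ(a°,L)/f̂ₐ(a†,L))·(b̂₀(M,L) − ĥ(L)) + 1{A=a°}·ĥ(L) ] − P(A=a°)·ψ₃ = E[ (h†(L) − ĥ(L))·(f̂ₐ(a°,L) − f(a°|L))/f̂ₐ(a†,L) ] + E[ Δ(L)·(f̂ₐ(a°,L) − f(a°|L))/f̂ₐ(a†,L) ] + E[ 1{A=a°}·g₁(L)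 ] + E[ 1{A=a°}·g₂(L) ], where Δ(l) = ∑_m (b̂₀(m,l) − b₀(m,l))·f(m|a†,l), g₁(l) = ∑_m f(m|a†,l)·(f(m|a°,l)/(f(m|a†,l)·f̂ₘ(m,a°,l)))·(f̂ₘ(m,a†,l) − f(m|a†,l))·(b₀(m,l) − b̂₀(m,l)), and g₂(l) = ∑_m f(m|a†,l)·(1/f̂ₘ(m,a°,l))·(f(m|a°,l) − f̂ₘ(m,a°,l))·(b₀(m,l) − b̂₀(m,l)). -/
open scoped Classical
open Finset

theorem fd_tower {Ω 𝓜 𝓛 α : Type*} [Fintype Ω] [Fintype 𝓜] [Fintype 𝓛]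
    (p : Ω → ℝ) (A : Ω → α) (M : Ω → 𝓜) (L : Ω → 𝓛) (Z : Ω → ℝ) (a : α) (F : 𝓜 → 𝓛 → ℝ) :
    Ex p (fun ω => ind (A ω = a) * F (M ω) (L ω) * Z ω) =
      ∑ l, ∑ m, F m l * Ex p (fun ω => Z ω * ind (A ω = a ∧ M ω = m ∧ L ω = l)) := by
  unfold Ex ind
  simp_rw [Finset.mul_sum]
  rw [Finset.sum_congr rfl (fun l _ => Finset.sum_comm), Finset.sum_comm]
  refine Finset.sum_congr rfl fun ω _ => ?_
  rw [Finset.sum_eq_single (L ω), Finset.sum_eq_single (M ω)]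
  · by_cases h : A ω = a <;> simp [h]
    ring
  · intro m _ hm
    simp [Ne.symm hm]
  · simp
  · intro l _ hl
    simp [Ne.symm hl]
  · simp

theorem fd_Pr {Ω : Type*} [Fintype Ω] (p : Ω → ℝ) (S : Ω → Prop) :
    Ex p (fun ω => 1 * ind (S ω)) = Pr p S := by
  unfold Ex Pr ind
  simp

theorem fd_tower1 {Ω 𝓜 𝓛 α : Type*} [Fintype Ω] [Fintype 𝓜] [Fintype 𝓛]
    (p : Ω → ℝ) (A : Ω → α) (M : Ω → 𝓜) (L : Ω → 𝓛) (a : α) (F : 𝓜 → 𝓛 → ℝ) :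
    Ex p (fun ω => ind (A ω = a) * F (M ω) (L ω)) =
      ∑ l, ∑ m, F m l * Pr p (fun ω => A ω = a ∧ M ω = m ∧ L ω = l) := by
  have h := fd_tower p A M L (fun _ => 1) a F
  simp_rw [fd_Pr, mul_one] at h
  exact h

theorem fd_add {Ω : Type*} [Fintype Ω] (p : Ω → ℝ) (X Z : Ω → ℝ) :
    Ex p (fun ω => X ω + Z ω) = Ex p X + Ex p Z := by
  simp [Ex, mul_add, Finset.sum_add_distrib]

theorem fd_sub {Ω : Type*} [Fintype Ω] (p : Ω → ℝ) (X Z : Ω → ℝ) :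
    Ex p (fun ω => X ω - Z ω) = Ex p X - Ex p Z := by
  simp [Ex, mul_sub, Finset.sum_sub_distrib]

theorem fd_marg {Ω 𝓜 : Type*} [Fintype Ω] [Fintype 𝓜]
    (p : Ω → ℝ) (M : Ω → 𝓜) (S T : Ω → Prop) :
    Pr p (fun ω => S ω ∧ T ω) = ∑ m, Pr p (fun ω => S ω ∧ M ω = m ∧ T ω) := by
  unfold Pr
  rw [Finset.sum_comm]
  refine Finset.sum_congr rfl fun ω _ => ?_
  rw [Finset.sum_eq_single (M ω)]
  · simp
  · intro m _ hm
    simp [Ne.symm hm]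
  · simp

/-- Second-order remainder decomposition for the generalized
frontdoor estimating function. -/
theorem generalized_frontdoor_remainder_decomposition
    {Ω 𝓜 𝓛 α : Type*} [Fintype Ω] [Fintype 𝓜] [Fintype 𝓛]
    (p : Ω → ℝ) (hp : ∀ ω, 0 ≤ p ω) (hsum : ∑ ω, p ω = 1)
    (A : Ω → α) (adag acirc : α) (hne : adag ≠ acirc)
    (hA : ∀ ω, A ω = adag ∨ A ω = acirc)
    (M : Ω → 𝓜) (L : Ω → 𝓛) (Y : Ω → ℝ)
    (hpos : ∀ a, (a = adag ∨ a = acirc) → ∀ m : 𝓜, ∀ l : 𝓛,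
      0 < Pr p (fun ω => A ω = a ∧ M ω = m ∧ L ω = l))
    -- true nuisance functions
    (fM : 𝓜 → α → 𝓛 → ℝ)
    (hfM : ∀ m a l, fM m a l =
      CPr p (fun ω => M ω = m) (fun ω => A ω = a ∧ L ω = l))
    (fA : α → 𝓛 → ℝ)
    (hfA : ∀ a l, fA a l = CPr p (fun ω => A ω = a) (fun ω => L ω = l))
    (b0 : 𝓜 → 𝓛 → ℝ)
    (hb0 : ∀ m l, b0 m l = CEx p Y (fun ω => A ω = acirc ∧ M ω = m ∧ L ω = l))
    (hdag : 𝓛 → ℝ)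
    (hhdag : ∀ l, hdag l = ∑ m : 𝓜, b0 m l * fM m adag l)
    (ψ3 : ℝ)
    (hψ3 : ψ3 = CEx p (fun ω => hdag (L ω)) (fun ω => A ω = acirc))
    -- estimated (arbitrary) nuisance functions
    (fhatM : 𝓜 → α → 𝓛 → ℝ)
    (hfhatMpos : ∀ m : 𝓜, ∀ a, (a = adag ∨ a = acirc) → ∀ l : 𝓛, 0 < fhatM m a l)
    (fhatA : α → 𝓛 → ℝ)
    (hfhatApos : ∀ a, (a = adag ∨ a = acirc) → ∀ l : 𝓛, 0 < fhatA a l)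
    (hfhatAsum : ∀ l : 𝓛, fhatA adag l + fhatA acirc l = 1)
    (b0hat : 𝓜 → 𝓛 → ℝ) (hhat : 𝓛 → ℝ)
    -- second-order terms
    (Δ : 𝓛 → ℝ)
    (hΔ : ∀ l, Δ l = ∑ m : 𝓜, (b0hat m l - b0 m l) * fM m adag l)
    (g1 : 𝓛 → ℝ)
    (hg1 : ∀ l, g1 l = ∑ m : 𝓜, fM m adag l *
      (fM m acirc l / (fM m adag l * fhatM m acirc l)) *
      (fhatM m adag l - fM m adag l) * (b0 m l - b0hat m l))
    (g2 : 𝓛 → ℝ)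
    (hg2 : ∀ l, g2 l = ∑ m : 𝓜, fM m adag l * (1 / fhatM m acirc l) *
      (fM m acirc l - fhatM m acirc l) * (b0 m l - b0hat m l)) :
    Ex p (fun ω =>
      ind (A ω = acirc) * (fhatM (M ω) adag (L ω) / fhatM (M ω) acirc (L ω)) *
        (Y ω - b0hat (M ω) (L ω)) +
      ind (A ω = adag) * (fhatA acirc (L ω) / fhatA adag (L ω)) *
        (b0hat (M ω) (L ω) - hhat (L ω)) +
      ind (A ω = acirc) * hhat (L ω))
    - Pr p (fun ω => A ω = acirc) * ψ3
    = Ex p (fun ω =>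
        (hdag (L ω) - hhat (L ω)) * (fhatA acirc (L ω) - fA acirc (L ω)) /
          fhatA adag (L ω)) +
      Ex p (fun ω =>
        Δ (L ω) * (fhatA acirc (L ω) - fA acirc (L ω)) / fhatA adag (L ω)) +
      Ex p (fun ω => ind (A ω = acirc) * g1 (L ω)) +
      Ex p (fun ω => ind (A ω = acirc) * g2 (L ω)) := by
  obtain ⟨ω0⟩ : Nonempty Ω := by
    by_contra h
    rw [not_nonempty_iff] at h
    simp at hsum
  have hM : Nonempty 𝓜 := ⟨M ω0⟩
  have hL : Nonempty 𝓛 := ⟨L ω0⟩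
  set w : α → 𝓜 → 𝓛 → ℝ := fun a m l => Pr p (fun ω => A ω = a ∧ M ω = m ∧ L ω = l) with hw
  have hwpos : ∀ a, (a = adag ∨ a = acirc) → ∀ m l, 0 < w a m l := hpos
  set W : α → 𝓛 → ℝ := fun a l => ∑ m, w a m l with hW
  have hWpos : ∀ a, (a = adag ∨ a = acirc) → ∀ l, 0 < W a l := fun a ha l =>
    Finset.sum_pos (fun m _ => hwpos a ha m l) Finset.univ_nonempty
  have hPW : ∀ a l, Pr p (fun ω => A ω = a ∧ L ω = l) = W a l := fun a l =>
    fd_marg p M (fun ω => A ω = a) (fun ω => L ω = l)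
  have hf : ∀ a, (a = adag ∨ a = acirc) → ∀ m l, w a m l = fM m a l * W a l := by
    intro a ha m l
    have : Pr p (fun ω => M ω = m ∧ A ω = a ∧ L ω = l) = w a m l := by
      simp only [hw]
      congr 1
      funext ω
      exact propext and_left_comm
    rw [hfM, CPr, hPW, this, div_mul_cancel₀ _ (hWpos a ha l).ne']
  have hPL : ∀ l, Pr p (fun ω => L ω = l) = W adag l + W acirc l := by
    intro l
    rw [← hPW, ← hPW]
    unfold Pr
    rw [← Finset.sum_add_distrib]
    refine Finset.sum_congr rfl fun ω _ => ?_
    rcases hA ω with h | h <;> simp [h, hne, hne.symm]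
  have hq : ∀ l, fA acirc l * (W adag l + W acirc l) = W acirc l := by
    intro l
    have h1 := hWpos adag (Or.inl rfl) l
    have h2 := hWpos acirc (Or.inr rfl) l
    rw [hfA, CPr, hPL, hPW, div_mul_cancel₀ _ (by positivity)]
  have hy : ∀ m l, Ex p (fun ω => Y ω * ind (A ω = acirc ∧ M ω = m ∧ L ω = l))
      = b0 m l * w acirc m l := by
    intro m l
    rw [hb0, CEx, div_mul_cancel₀ _ (hwpos acirc (Or.inr rfl) m l).ne']
    rfl
  have hfsum : ∀ l, ∑ m, fM m adag l = 1 := by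
    intro l
    have h1 := hWpos adag (Or.inl rfl) l
    have h2 : W adag l = (∑ m, fM m adag l) * W adag l := by
      rw [Finset.sum_mul]
      exact Finset.sum_congr rfl fun m _ => hf adag (Or.inl rfl) m l
    exact mul_right_cancel₀ h1.ne' (by rw [← h2, one_mul])
  have hfpos : ∀ m l, fM m adag l ≠ 0 := by
    intro m l h
    have h1 := hwpos adag (Or.inl rfl) m l
    rw [hf adag (Or.inl rfl), h, zero_mul] at h1
    exact lt_irrefl _ h1
  -- tower for functions of L
  have tL : ∀ a (F : 𝓛 → ℝ), Ex p (fun ω => ind (A ω = a) * F (L ω)) = ∑ l, F l * W a l := by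
    intro a F
    rw [fd_tower1 p A M L a (fun _ l => F l)]
    simp_rw [hW, Finset.mul_sum, hw]
  have tL' : ∀ (F : 𝓛 → ℝ), Ex p (fun ω => F (L ω)) = ∑ l, F l * (W adag l + W acirc l) := by
    intro F
    simp_rw [mul_add, Finset.sum_add_distrib]
    rw [← tL, ← tL, ← fd_add]
    congr 1
    funext ω
    rcases hA ω with h | h <;> simp [ind, h, hne, hne.symm]
  have hψ : Pr p (fun ω => A ω = acirc) * ψ3 = ∑ l, hdag l * W acirc l := by
    have hP : Pr p (fun ω => A ω = acirc) = ∑ l, W acirc l := by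
      have h := tL acirc (fun _ => 1)
      simp only [one_mul] at h
      rw [← h]
      simp [Pr, Ex, ind]
    have hP' : Pr p (fun ω => A ω = acirc) ≠ 0 := by
      rw [hP]
      exact (Finset.sum_pos (fun l _ => hWpos acirc (Or.inr rfl) l) Finset.univ_nonempty).ne'
    rw [hψ3, CEx, mul_div_cancel₀ _ hP', ← tL]
    congr 1
    funext ω
    simp only [ind]
    ring
  have hT1 : Ex p (fun ω => ind (A ω = acirc) *
        (fhatM (M ω) adag (L ω) / fhatM (M ω) acirc (L ω)) * (Y ω - b0hat (M ω) (L ω)))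
      = ∑ l, (∑ m, fhatM m adag l / fhatM m acirc l * (b0 m l - b0hat m l) * fM m acirc l)
          * W acirc l := by
    have e1 := fd_tower p A M L Y acirc (fun m l => fhatM m adag l / fhatM m acirc l)
    have e2 := fd_tower1 p A M L acirc
      (fun m l => fhatM m adag l / fhatM m acirc l * b0hat m l)
    simp only [hy] at e1
    simp only [mul_sub]
    rw [fd_sub, e1]
    simp only [mul_assoc] at e2 ⊢
    rw [e2, ← Finset.sum_sub_distrib]
    refine Finset.sum_congr rfl fun l _ => ?_
    rw [← Finset.sum_sub_distrib, Finset.sum_mul]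
    refine Finset.sum_congr rfl fun m _ => ?_
    have := hf acirc (Or.inr rfl) m l
    simp only [hw] at this ⊢
    rw [this]
    ring
  have hT2 : Ex p (fun ω => ind (A ω = adag) * (fhatA acirc (L ω) / fhatA adag (L ω)) *
        (b0hat (M ω) (L ω) - hhat (L ω)))
      = ∑ l, fhatA acirc l / fhatA adag l *
          ((∑ m, b0hat m l * fM m adag l) - hhat l) * W adag l := by
    have e2 := fd_tower1 p A M L adag
      (fun m l => fhatA acirc l / fhatA adag l * (b0hat m l - hhat l))
    simp only [← mul_assoc] at e2
    rw [e2]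
    refine Finset.sum_congr rfl fun l _ => ?_
    have : hhat l = ∑ m, hhat l * fM m adag l := by rw [← Finset.mul_sum, hfsum, mul_one]
    conv_rhs => rw [this, ← Finset.sum_sub_distrib,
      Finset.mul_sum _ _ (fhatA acirc l / fhatA adag l), Finset.sum_mul]
    refine Finset.sum_congr rfl fun m _ => ?_
    have := hf adag (Or.inl rfl) m l
    simp only [hw] at this ⊢
    rw [this]
    ring
  rw [fd_add, fd_add, hT1, hT2, tL, hψ, tL, tL,
    tL' (fun l => (hdag l - hhat l) * (fhatA acirc l - fA acirc l) / fhatA adag l),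
    tL' (fun l => Δ l * (fhatA acirc l - fA acirc l) / fhatA adag l)]
  simp only [← Finset.sum_add_distrib, ← Finset.sum_sub_distrib]
  refine Finset.sum_congr rfl fun l _ => ?_
  have hD : Δ l = (∑ m, b0hat m l * fM m adag l) - hdag l := by
    rw [hΔ, hhdag, ← Finset.sum_sub_distrib]
    exact Finset.sum_congr rfl fun m _ => by ring
  have hg : g1 l + g2 l =
      (∑ m, fhatM m adag l / fhatM m acirc l * (b0 m l - b0hat m l) * fM m acirc l) + Δ l := by
    rw [hg1, hg2, hΔ, ← Finset.sum_add_distrib, ← Finset.sum_add_distrib]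
    refine Finset.sum_congr rfl fun m _ => ?_
    have h1 := hfpos m l
    have h2 := (hfhatMpos m acirc (Or.inr rfl) l).ne'
    field_simp
    ring
  have hs := (hfhatApos adag (Or.inl rfl) l).ne'
  have hr : fhatA acirc l = 1 - fhatA adag l := by linarith [hfhatAsum l]
  have hql := hq l
  generalize (∑ m, fhatM m adag l / fhatM m acirc l * (b0 m l - b0hat m l) * fM m acirc l) = T
    at hg ⊢
  generalize (∑ m, b0hat m l * fM m adag l) = B at hD ⊢
  have hT : T = g1 l + g2 l - Δ l := by linarith
  have hB : B = Δ l + hdag l := by linarith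
  rw [hT, hB, hr]
  generalize W adag l = Wd at *
  generalize W acirc l = Wc at *
  field_simp
  linear_combination (Δ l + hdag l - hhat l) * hql
end
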